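/- There exist a closed set C ⊆ [0,1] of Hausdorff dimension 1 and a sequence (q_n) of positive integers such that lim_{n→∞} ‖q_n α‖ = 0 for every α ∈ C, and sup_n ∑_{p prime, p ∣ q_n} 1/p < +∞. -/

import Mathlib

open Filter MeasureTheory

namespace RigidAux

/-- Positions of the free binary digits. -/
def sg (i : ℕ) : ℕ := i + Nat.sqrt i * Nat.sqrt (Nat.sqrt i)

lemma sg_strictMono : StrictMono sg := by
  intro i j hij
  unfold sg
  have h1 := Nat.sqrt_le_sqrt hij.le
  have h2 := Nat.sqrt_le_sqrt h1
  have := Nat.mul_le_mul h1 h2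
  omega

lemma sqrt_end (n : ℕ) : Nat.sqrt (n * n + 2 * n) = n := by
  refine le_antisymm ?_ (Nat.le_sqrt.2 (by omega))
  have : Nat.sqrt (n * n + 2 * n) < n + 1 := Nat.sqrt_lt.2 (by nlinarith)
  omega

lemma sg_gap (n : ℕ) : sg (n * n + 2 * n) + 1 + Nat.sqrt (n + 1) ≤ sg (n * n + 2 * n + 1) := by
  unfold sg
  rw [sqrt_end, show n * n + 2 * n + 1 = (n + 1) * (n + 1) by ring, Nat.sqrt_eq]
  have := Nat.sqrt_le_sqrt (Nat.le_succ n)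
  have := Nat.mul_le_mul_left n this
  simp only [Nat.succ_eq_add_one] at this
  nlinarith

/-- The weights. -/
noncomputable def w (i : ℕ) : ℝ := (1 / 2) ^ (sg i + 1)

lemma w_pos (i : ℕ) : 0 < w i := by unfold w; positivity

lemma sg_add (k j : ℕ) : sg k + j ≤ sg (k + j) := by
  induction j with
  | zero => simp
  | succ j ih =>
    have := sg_strictMono (show k + j < k + (j + 1) by omega)
    omega

lemma w_add (k j : ℕ) : w (j + k) ≤ w k * (1 / 2) ^ j := by
  unfold w
  rw [← pow_add]
  apply pow_le_pow_of_le_one (by norm_num) (by norm_num)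
  have := sg_add k j
  rw [add_comm j k]; omega

lemma summable_w : Summable w := by
  refine Summable.of_nonneg_of_le (fun i => (w_pos i).le) (fun i => ?_)
    (summable_geometric_two.mul_left (w 0))
  exact w_add 0 i

lemma tail_w (k : ℕ) : ∑' j, w (j + k) ≤ 2 * w k := by
  have h1 : Summable fun j => w (j + k) := (summable_nat_add_iff k).2 summable_w
  calc ∑' j, w (j + k) ≤ ∑' j, w k * (1 / 2) ^ j :=
        h1.tsum_le_tsum (fun j => w_add k j) (summable_geometric_two.mul_left _)
    _ = 2 * w k := by rw [tsum_mul_left, tsum_geometric_two]; ring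

lemma dig_le (d : Fin 2) : ((d : ℕ) : ℝ) ≤ 1 := by
  have := d.2
  exact_mod_cast (by omega : (d : ℕ) ≤ 1)

/-- The parametrization. -/
noncomputable def g (a : ℕ → Fin 2) : ℝ := ∑' i, ((a i : ℕ) : ℝ) * w i

lemma term_le (a : ℕ → Fin 2) (i : ℕ) : ((a i : ℕ) : ℝ) * w i ≤ w i :=
  mul_le_of_le_one_left (w_pos i).le (dig_le _)

lemma term_nonneg (a : ℕ → Fin 2) (i : ℕ) : 0 ≤ ((a i : ℕ) : ℝ) * w i :=
  mul_nonneg (Nat.cast_nonneg _) (w_pos i).le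

lemma summable_term (a : ℕ → Fin 2) : Summable fun i => ((a i : ℕ) : ℝ) * w i :=
  Summable.of_nonneg_of_le (term_nonneg a) (term_le a) summable_w

lemma g_split (a : ℕ → Fin 2) (k : ℕ) :
    ∃ t : ℝ, 0 ≤ t ∧ t ≤ 2 * w k ∧ g a = ∑ i ∈ Finset.range k, ((a i : ℕ) : ℝ) * w i + t := by
  have hs := (summable_nat_add_iff k).2 (summable_term a)
  refine ⟨∑' j, ((a (j + k) : ℕ) : ℝ) * w (j + k), tsum_nonneg fun j => term_nonneg a _, ?_, ?_⟩
  · refine le_trans (hs.tsum_le_tsum (fun j => term_le a _) ?_) (tail_w k)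
    exact (summable_nat_add_iff k).2 summable_w
  · exact ((summable_term a).sum_add_tsum_nat_add k).symm

lemma g_cont : Continuous g := by
  refine continuous_tsum (u := w) (fun i => ?_) summable_w (fun i a => ?_)
  · have : Continuous fun d : Fin 2 => ((d : ℕ) : ℝ) := continuous_of_discreteTopology
    exact (this.comp (continuous_apply i)).mul continuous_const
  · rw [Real.norm_of_nonneg (term_nonneg a i)]; exact term_le a i

lemma g_mem (a : ℕ → Fin 2) : g a ∈ Set.Icc (0 : ℝ) 1 := by
  obtain ⟨t, h0, h1, h2⟩ := g_split a 0
  have : w 0 = 1 / 2 := by simp [w, sg]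
  rw [this] at h1
  simp at h2
  rw [h2]
  exact ⟨h0, by linarith⟩

lemma g_sep_fin (a b : ℕ → Fin 2) (i : ℕ) (hlt : ∀ j < i, a j = b j) (ha : a i = 1) (hb : b i = 0)
    (k : ℕ) (hk : i ≤ k) :
    w k ≤ ∑ j ∈ Finset.range (k + 1), ((a j : ℕ) : ℝ) * w j
      - ∑ j ∈ Finset.range (k + 1), ((b j : ℕ) : ℝ) * w j := by
  induction k, hk using Nat.le_induction with
  | base =>
    rw [Finset.sum_range_succ, Finset.sum_range_succ, ha, hb,
      Finset.sum_congr rfl (fun j hj => by rw [hlt j (Finset.mem_range.1 hj)])]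
    simp
  | succ k hk ih =>
    rw [Finset.sum_range_succ _ (k + 1), Finset.sum_range_succ _ (k + 1)]
    have h1 := term_nonneg a (k + 1)
    have h2 := term_le b (k + 1)
    have h3 := w_add k 1
    rw [add_comm 1 k] at h3
    linarith

lemma g_sep (a b : ℕ → Fin 2) (i : ℕ) (hlt : ∀ j < i, a j = b j) (ha : a i = 1) (hb : b i = 0)
    (n : ℕ) (hk : i ≤ n * n + 2 * n) :
    (1 / 2 : ℝ) ^ (sg (n * n + 2 * n) + 2) ≤ g a - g b := by
  have h := g_sep_fin a b i hlt ha hb _ hk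
  obtain ⟨t, h0, h1, h2⟩ := g_split a (n * n + 2 * n + 1)
  obtain ⟨t', h0', h1', h2'⟩ := g_split b (n * n + 2 * n + 1)
  have h4 : w (n * n + 2 * n + 1) ≤ w (n * n + 2 * n) * (1 / 2) ^ 2 := by
    unfold w
    rw [← pow_add]
    apply pow_le_pow_of_le_one (by norm_num) (by norm_num)
    have := sg_gap n
    have : 0 < Nat.sqrt (n + 1) := Nat.sqrt_pos.2 (by omega)
    omega
  have h5 : (1 / 2 : ℝ) ^ (sg (n * n + 2 * n) + 2) = w (n * n + 2 * n) * (1 / 2) := by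
    unfold w; rw [← pow_succ]
  rw [h2, h2', h5]
  linarith

lemma growth (s : ℝ) (h0 : 0 < s) (h1 : s < 1) : ∃ c : ℝ, ∀ i : ℕ,
    s * ((sg (Nat.sqrt i * Nat.sqrt i + 2 * Nat.sqrt i) + 2 : ℕ) : ℝ) ≤ i + c := by
  refine ⟨5 + 5 * (5 / (1 - s)) ^ 3, fun i => ?_⟩
  have hi : Nat.sqrt i * Nat.sqrt i ≤ i := Nat.sqrt_le i
  unfold sg
  rw [sqrt_end]
  set r := Nat.sqrt i
  have ht : Nat.sqrt r * Nat.sqrt r ≤ r := Nat.sqrt_le r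
  set t := Nat.sqrt r
  have hi' : (r : ℝ) * r ≤ i := by exact_mod_cast hi
  have ht' : (t : ℝ) * t ≤ r := by exact_mod_cast ht
  push_cast
  set u := Real.sqrt r with hu
  have hu0 : 0 ≤ u := Real.sqrt_nonneg _
  have hur : u ^ 2 = r := Real.sq_sqrt (Nat.cast_nonneg _)
  have htu : (t : ℝ) ≤ u := Real.le_sqrt_of_sq_le (by nlinarith)
  rw [← hur] at hi' ⊢
  have hpos : 0 < 1 - s := by linarith
  have hb : u ^ 2 * u ^ 2 + 2 * u ^ 2 + u ^ 2 * t + 2 ≤ u ^ 4 + (5 * u ^ 3 + 5) := by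
    have : u ^ 2 * t ≤ u ^ 2 * u := by gcongr
    have : u ^ 2 ≤ 1 + u ^ 3 := by
      rcases le_total u 1 with h | h
      · nlinarith [pow_nonneg hu0 3]
      · nlinarith [pow_nonneg hu0 2]
    nlinarith [pow_nonneg hu0 3]
  have hc : s * (u ^ 4 + (5 * u ^ 3 + 5)) ≤ u ^ 4 + (5 + 5 * (5 / (1 - s)) ^ 3) := by
    have hM : 0 ≤ 5 / (1 - s) := by positivity
    have hs : s * (5 * u ^ 3 + 5) ≤ 5 * u ^ 3 + 5 := by
      apply mul_le_of_le_one_left _ h1.le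
      positivity
    have key : 5 * u ^ 3 ≤ (1 - s) * u ^ 4 + 5 * (5 / (1 - s)) ^ 3 := by
      rcases le_total u (5 / (1 - s)) with h | h
      · have : u ^ 3 ≤ (5 / (1 - s)) ^ 3 := by gcongr
        have : 0 ≤ (1 - s) * u ^ 4 := by positivity
        linarith
      · rw [div_le_iff₀ hpos] at h
        have : 5 * u ^ 3 ≤ (u * (1 - s)) * u ^ 3 := by gcongr
        have : 0 ≤ 5 * (5 / (1 - s)) ^ 3 := by positivity
        nlinarith
    nlinarith
  have := mul_le_mul_of_nonneg_left hb h0.le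
  nlinarith

lemma holder_aux (s c : ℝ) (h0 : 0 < s)
    (hc : ∀ i : ℕ, s * ((sg (Nat.sqrt i * Nat.sqrt i + 2 * Nat.sqrt i) + 2 : ℕ) : ℝ) ≤ i + c)
    (a b : ℕ → Fin 2) (i : ℕ) (hlt : ∀ j < i, a j = b j) (ha : a i = 1) (hb : b i = 0) :
    |Real.ofDigits a - Real.ofDigits b| ≤ 2 ^ c * |g a - g b| ^ s := by
  have hik : i ≤ Nat.sqrt i * Nat.sqrt i + 2 * Nat.sqrt i := by
    have := Nat.sqrt_le_add i
    omega
  have h1 := g_sep a b i hlt ha hb _ hik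
  have h2 := hc i
  set m := sg (Nat.sqrt i * Nat.sqrt i + 2 * Nat.sqrt i) + 2
  have h3 := Real.abs_ofDigits_sub_ofDigits_le (n := i) (x := a) (y := b) hlt
  have h4 : ((1 / 2 : ℝ) ^ m) ^ s ≤ |g a - g b| ^ s :=
    Real.rpow_le_rpow (by positivity) (h1.trans (le_abs_self _)) h0.le
  have h5 : ((1 / 2 : ℝ) ^ m) ^ s = 2 ^ (-(s * m)) := by
    rw [one_div, inv_pow, ← Real.rpow_natCast, ← Real.rpow_neg (by norm_num),
      ← Real.rpow_mul (by norm_num)]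
    congr 1; ring
  calc |Real.ofDigits a - Real.ofDigits b| ≤ (2 : ℝ) ^ (-(i : ℝ)) := by
        rw [Real.rpow_neg (by norm_num), Real.rpow_natCast]
        simpa using h3
    _ ≤ (2 : ℝ) ^ (c + -(s * m)) := by
        apply Real.rpow_le_rpow_of_exponent_le (by norm_num)
        linarith
    _ = 2 ^ c * ((1 / 2 : ℝ) ^ m) ^ s := by rw [h5, Real.rpow_add (by norm_num)]
    _ ≤ _ := by gcongr

lemma holder_real (s : ℝ) (h0 : 0 < s) (h1 : s < 1) : ∃ K : ℝ, 0 ≤ K ∧ ∀ a b : ℕ → Fin 2,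
    |Real.ofDigits a - Real.ofDigits b| ≤ K * |g a - g b| ^ s := by
  obtain ⟨c, hc⟩ := growth s h0 h1
  refine ⟨2 ^ c, by positivity, fun a b => ?_⟩
  by_cases hab : a = b
  · subst hab
    simp only [sub_self, abs_zero]
    positivity
  have hex : ∃ i, a i ≠ b i := Function.ne_iff.1 hab
  classical
  have hi := Nat.find_spec hex
  have hmin : ∀ j < Nat.find hex, a j = b j := fun j hj => not_not.1 (Nat.find_min hex hj)
  set i := Nat.find hex
  have hcase : (a i = 1 ∧ b i = 0) ∨ (b i = 1 ∧ a i = 0) := by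
    revert hi
    generalize a i = x
    generalize b i = y
    revert x y
    decide
  rcases hcase with ⟨h, h'⟩ | ⟨h, h'⟩
  · exact holder_aux s c h0 hc a b i hmin h h'
  · rw [abs_sub_comm, abs_sub_comm (g a)]
    exact holder_aux s c h0 hc b a i (fun j hj => (hmin j hj).symm) h h'

lemma dim_ge (s : NNReal) (h0 : 0 < s) (h1 : s < 1) : (s : ENNReal) ≤ dimH (Set.range g) := by
  obtain ⟨K, hK, h⟩ := holder_real s h0 h1
  let f : ℝ → ℝ := fun x => Real.ofDigits (Function.invFun g x)
  have hinv : ∀ a, g (Function.invFun g (g a)) = g a := fun a => Function.invFun_eq ⟨a, rfl⟩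
  have hf : ∀ a, f (g a) = Real.ofDigits a := by
    intro a
    have := h (Function.invFun g (g a)) a
    rw [hinv, sub_self, abs_zero, Real.zero_rpow (by exact_mod_cast h0.ne'), mul_zero] at this
    exact sub_eq_zero.1 (abs_nonpos_iff.1 this)
  have hH : HolderOnWith K.toNNReal s f (Set.range g) := by
    rintro _ ⟨a, rfl⟩ _ ⟨b, rfl⟩
    rw [hf, hf, edist_dist, edist_dist, Real.dist_eq, Real.dist_eq,
      ENNReal.ofReal_rpow_of_nonneg (abs_nonneg _) s.coe_nonneg]
    change _ ≤ ENNReal.ofReal K * _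
    rw [← ENNReal.ofReal_mul hK]
    exact ENNReal.ofReal_le_ofReal (h a b)
  have h2 := hH.dimH_image_le h0
  have h3 : Set.Icc (0 : ℝ) 1 ⊆ f '' Set.range g := by
    intro x hx
    obtain ⟨a, -, rfl⟩ := Real.ofDigits_SurjOn (b := 2) (by norm_num) hx
    exact ⟨g a, ⟨a, rfl⟩, hf a⟩
  have h4 : dimH (Set.Icc (0 : ℝ) 1) = 1 := by
    rw [Real.dimH_of_nonempty_interior (by simp)]
    simp
  have h5 := (dimH_mono h3).trans h2
  rw [h4, ENNReal.le_div_iff_mul_le (Or.inl (by exact_mod_cast h0.ne'))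
    (Or.inl ENNReal.coe_ne_top), one_mul] at h5
  exact h5

lemma dim_eq : dimH (Set.range g) = 1 := by
  apply le_antisymm
  · exact (dimH_mono (Set.subset_univ _)).trans Real.dimH_univ.le
  · refine ENNReal.le_of_forall_nnreal_lt fun s hs => ?_
    have hs' : s < 1 := by exact_mod_cast hs
    rcases eq_or_lt_of_le (zero_le (a := s)) with h | h
    · simp [← h]
    · exact dim_ge s h hs'

lemma near (a : ℕ → Fin 2) (n : ℕ) :
    |((2 ^ (sg (n * n + 2 * n) + 1) : ℕ) : ℝ) * g a
      - round (((2 ^ (sg (n * n + 2 * n) + 1) : ℕ) : ℝ) * g a)| ≤ (1 / 2) ^ (Nat.sqrt (n + 1)) := by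
  obtain ⟨t, h0, h1, h2⟩ := g_split a (n * n + 2 * n + 1)
  have hgap := sg_gap n
  set k := n * n + 2 * n
  set Q : ℝ := ((2 ^ (sg k + 1) : ℕ) : ℝ) with hQ
  have hint : Q * ∑ i ∈ Finset.range (k + 1), ((a i : ℕ) : ℝ) * w i
      = ((∑ i ∈ Finset.range (k + 1), (a i : ℕ) * 2 ^ (sg k - sg i) : ℕ) : ℤ) := by
    push_cast
    rw [Finset.mul_sum]
    refine Finset.sum_congr rfl fun i hi => ?_
    have hik : sg i ≤ sg k := sg_strictMono.monotone (by
      have := Finset.mem_range.1 hi; omega)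
    have : Q * w i = 2 ^ (sg k - sg i) := by
      rw [hQ, w, one_div, inv_pow]
      push_cast
      rw [pow_sub₀ _ (by norm_num) hik, pow_succ, pow_succ]
      field_simp
    rw [← this]; ring
  refine (round_le _
    ((∑ i ∈ Finset.range (k + 1), (a i : ℕ) * 2 ^ (sg k - sg i) : ℕ) : ℤ)).trans ?_
  rw [h2, mul_add, hint, add_sub_cancel_left, abs_of_nonneg (by positivity)]
  calc Q * t ≤ Q * (2 * w (k + 1)) := by gcongr
    _ ≤ Q * (2 * (1 / 2) ^ (sg k + 1 + Nat.sqrt (n + 1) + 1)) := by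
        have : w (k + 1) ≤ (1 / 2) ^ (sg k + 1 + Nat.sqrt (n + 1) + 1) :=
          pow_le_pow_of_le_one (by norm_num) (by norm_num) (by omega)
        gcongr
    _ = (1 / 2) ^ (Nat.sqrt (n + 1)) := by
        rw [hQ]
        push_cast
        rw [pow_succ (1 / 2 : ℝ) (sg k + 1 + Nat.sqrt (n + 1)), pow_add (1 / 2 : ℝ) (sg k + 1)]
        have : (2 : ℝ) ^ (sg k + 1) * (1 / 2) ^ (sg k + 1) = 1 := by
          rw [← mul_pow]; norm_num
        linear_combination (1 / 2 : ℝ) ^ (Nat.sqrt (n + 1)) * this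

lemma tendsto_sqrt : Tendsto (fun n : ℕ => Nat.sqrt (n + 1)) atTop atTop := by
  refine tendsto_atTop.2 fun b => ?_
  filter_upwards [eventually_ge_atTop (b * b)] with n hn
  exact Nat.le_sqrt.2 (by omega)

end RigidAux

theorem full_hausdorff_dimension_rigid_set :
    ∃ C : Set ℝ, C ⊆ Set.Icc 0 1 ∧ IsClosed C ∧ dimH C = 1 ∧
      ∃ q : ℕ → ℕ, (∀ n, 0 < q n) ∧
        (∀ α ∈ C, Filter.Tendsto
          (fun n => |(q n : ℝ) * α - round ((q n : ℝ) * α)|) Filter.atTop (nhds 0)) ∧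
        ∃ B : ℝ, ∀ n, ∑ p ∈ (q n).primeFactors, (1 : ℝ) / p ≤ B := by
  refine ⟨Set.range RigidAux.g, ?_, (isCompact_range RigidAux.g_cont).isClosed, RigidAux.dim_eq,
    fun n => 2 ^ (RigidAux.sg (n * n + 2 * n) + 1), fun n => by positivity, ?_, 1 / 2, fun n => ?_⟩
  · rintro _ ⟨a, rfl⟩
    exact RigidAux.g_mem a
  · rintro _ ⟨a, rfl⟩
    refine squeeze_zero (fun n => abs_nonneg _) (RigidAux.near a) ?_
    exact (tendsto_pow_atTop_nhds_zero_of_lt_one (by norm_num) (by norm_num)).comp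
      RigidAux.tendsto_sqrt
  · rw [Nat.primeFactors_prime_pow (Nat.succ_ne_zero _) Nat.prime_two]
    simp
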